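/- arXiv:2306.00126 — 2 statements merged into one kernel-verified Lean document; each statement's English description precedes it below -/
import Mathlib

section
/- Normalizer bounds for informed proposals at overfitted trees: Under the assumptions of the informed-mixing theorem (Bayesian CART prior with p_{lk} = n^{-c}, Assumption 1 with sufficiently large A), with probability at least 1 − 4/n − e^{−n/8} over ε ~ N(0, I_n), for every overfitted tree 𝒯 ∈ 𝕋_L (𝒯 ⊇ 𝒯*): (i) Z_g(𝒯) ≤ n^{−(c−5/2)}/2; (ii) for every PRUNE-neighbor 𝒯̃ ⊂ 𝒯, w_p(𝒯̃|𝒯) = n^{c−3/2} if 𝒯̃ ⊇ 𝒯* and w_p(𝒯̃|𝒯) = 1 otherwise; (iii) for the informed Bayesian CART, Z_p(𝒯) ≤ |a_𝒯| + |b_𝒯|·n^{c−3/2}, where a_𝒯 = 𝒫(𝒯) ∩ 𝒯*_int and b_𝒯 = 𝒫(𝒯) ∖ 𝒯*_int with 𝒫(𝒯) the set of pre-terminal nodes of 𝒯. -/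
open Finset MeasureTheory Real
open scoped BigOperators NNReal ENNReal

noncomputable section

namespace BayesCART

/-! ## Trees

Nodes of the dyadic (Haar wavelet) tree are encoded by the index `j = 2^l + k`
(the root `ψ_{-1,0}` is `j = 0`, and `ψ_{l,k} ↦ 2^l + k` for `l ≥ 0`, `0 ≤ k < 2^l`).
The children of a node `j ≥ 1` are `2j` and `2j+1`, the unique child of the root `0`
is `1`, and the parent of `j ≥ 1` is `j / 2`.  A tree is identified with the finite
set `S` of its internal nodes, which must contain the root and be ancestor-closed. -/

/-- `S` is the internal-node set of a tree all of whose internal nodes have depth `< L`. -/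
def IsTree (L : ℕ) (S : Finset ℕ) : Prop :=
  0 ∈ S ∧ (∀ j ∈ S, 1 ≤ j → j / 2 ∈ S) ∧ ∀ j ∈ S, j < 2 ^ L

instance (L : ℕ) : DecidablePred (IsTree L) := fun _ => by unfold IsTree; infer_instance

/-- The (finite) collection `𝕋_L` of all trees with internal nodes of depth `< L`. -/
def trees (L : ℕ) : Finset (Finset ℕ) :=
  (Finset.range (2 ^ L)).powerset.filter (IsTree L)

/-- The external (leaf) nodes `𝒯_ext` of the tree with internal nodes `S`. -/
def extSet (S : Finset ℕ) : Finset ℕ :=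
  ((S.image fun j => 2 * j) ∪ S.image fun j => 2 * j + 1).filter fun j => j ∉ S

/-! ## The Haar design -/

/-- The Haar mother wavelet `ψ = 1_{(0,1/2]} − 1_{(1/2,1]}`. -/
def haarMother (x : ℝ) : ℝ :=
  if 0 < x ∧ x ≤ 1 / 2 then 1 else if 1 / 2 < x ∧ x ≤ 1 then -1 else 0

/-- Entry `i` of column `j` of the Haar design matrix with `n` observations at the
design points `x_i = (i+1)/n`: column `j = 0` is `ψ_{-1,0} ≡ 1`, and column
`j = 2^l + k ≥ 1` is `ψ_{lk}(x) = 2^{l/2} ψ(2^l x − k)`. -/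
def haarCol (n j i : ℕ) : ℝ :=
  if j = 0 then 1
  else
    (2 : ℝ) ^ ((Nat.log 2 j : ℝ) / 2) *
      haarMother ((2 : ℝ) ^ (Nat.log 2 j) * ((i + 1 : ℝ) / n) - ((j - 2 ^ Nat.log 2 j : ℕ) : ℝ))

/-- The inner product `X_j' Y` of the `j`-th design column with a vector `Y ∈ ℝⁿ`. -/
def colDot (n : ℕ) (Y : Fin n → ℝ) (j : ℕ) : ℝ := ∑ i : Fin n, haarCol n j i.val * Y i

/-- The vector `X β* = Σ_{j ∈ B} β*_j ψ_j` of values of `f₀` at the design points. -/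
def signalVec (n : ℕ) (β : ℕ → ℝ) (B : Finset ℕ) : Fin n → ℝ :=
  fun i => ∑ j ∈ B, β j * haarCol n j i.val

/-- The response `Y = X β* + ε`. -/
def Yvec (n : ℕ) (β : ℕ → ℝ) (B : Finset ℕ) (ε : Fin n → ℝ) : Fin n → ℝ :=
  fun i => signalVec n β B i + ε i

/-- The standard Gaussian measure of `ε = (ε_1, …, ε_n) ~ N(0, I_n)`. -/
def gauss (n : ℕ) : Measure (Fin n → ℝ) :=
  Measure.pi fun _ => ProbabilityTheory.gaussianReal 0 1

/-! ## Prior and posterior -/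

/-- The split probability `p_{lk} = n^{-c}`. -/
def splitP (n : ℕ) (c : ℝ) : ℝ := (n : ℝ) ^ (-c)

/-- Unnormalized Galton–Watson tree prior `Π(𝒯) ∝ ∏_{int} p ∏_{ext} (1 − p)`
with constant split probability `p`. -/
def priorWt (p : ℝ) (S : Finset ℕ) : ℝ := p ^ S.card * (1 - p) ^ (extSet S).card

/-- The marginal likelihood
`N_Y(𝒯) = (2π)^{-n/2} (1+n)^{-|𝒯_ext|/2} exp{−½ Y'[I − X_𝒯 Σ_𝒯 X_𝒯'] Y}`;
for the orthogonal Haar design (`X'X = nI`) with `Σ_𝒯 = (n/(n+1))(X_𝒯'X_𝒯)^{-1}`,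
`Y' X_𝒯 Σ_𝒯 X_𝒯' Y = (n+1)^{-1} Σ_{j ∈ 𝒯_int} (X_j'Y)²`. -/
def margLik (n : ℕ) (Y : Fin n → ℝ) (S : Finset ℕ) : ℝ :=
  (2 * π) ^ (-(n : ℝ) / 2) * ((1 + n : ℝ) ^ (-((extSet S).card : ℝ) / 2)) *
    Real.exp (-(1 / 2) * ((∑ i, Y i ^ 2) - (1 / ((n : ℝ) + 1)) * ∑ j ∈ S, colDot n Y j ^ 2))

/-- Unnormalized posterior weight `Π(𝒯) N_Y(𝒯)`. -/
def postWt (n : ℕ) (p : ℝ) (Y : Fin n → ℝ) (S : Finset ℕ) : ℝ :=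
  priorWt p S * margLik n Y S

/-- Posterior probability `Π(𝒯 ∣ Y)` of a single tree in `𝕋_L`. -/
def post (L n : ℕ) (p : ℝ) (Y : Fin n → ℝ) (S : Finset ℕ) : ℝ :=
  postWt n p Y S / ∑ T ∈ trees L, postWt n p Y T

/-- Posterior probability of a family of trees. -/
def postSet (L n : ℕ) (p : ℝ) (Y : Fin n → ℝ) (A : Finset (Finset ℕ)) : ℝ :=
  ∑ T ∈ A ∩ trees L, post L n p Y T

/-! ## Assumption 1 -/

/-- Assumption 1: `f₀ = Σ_{(l,k) ∈ ℬ} β*_{lk} ψ_{lk}` with all signal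
coefficients of magnitude in `(A log n / √n, C)`, and `𝒯* ∈ 𝕋_L` is the smallest
tree containing `ℬ` among its internal nodes. -/
structure Assumption1 (L n : ℕ) (A C : ℝ) (β : ℕ → ℝ) (B Sstar : Finset ℕ) : Prop where
  B_depth : ∀ j ∈ B, j < 2 ^ L
  signal_low : ∀ j ∈ B, A * Real.log n / Real.sqrt n < |β j|
  signal_high : ∀ j ∈ B, |β j| < C
  support : ∀ j, j ∉ B → β j = 0
  Sstar_tree : Sstar ∈ trees L
  Sstar_contains : B ⊆ Sstar
  Sstar_min : ∀ T ∈ trees L, B ⊆ T → Sstar ⊆ T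

/-! ## The Bayesian CART proposal -/

/-- GROW candidates: external nodes of depth `< L`. -/
def growCands (L : ℕ) (S : Finset ℕ) : Finset ℕ := (extSet S).filter fun j => j < 2 ^ L

/-- PRUNE candidates: pre-terminal internal nodes (no children internal), root excluded. -/
def pruneCands (S : Finset ℕ) : Finset ℕ :=
  S.filter fun j => j ≠ 0 ∧ 2 * j ∉ S ∧ 2 * j + 1 ∉ S

/-- The GROW/PRUNE proposal kernel of (dyadic) Bayesian CART: GROW and PRUNE are
chosen with probability `1/2` each (with forced moves at the null and the full tree),
a GROW splits a uniformly chosen external node, and a PRUNE collapses a uniformly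
chosen pre-terminal node. -/
def bcartProp (L : ℕ) (S S' : Finset ℕ) : ℝ :=
  (if (pruneCands S).Nonempty then (1 : ℝ) / 2 else 1) *
      (((growCands L S).filter fun j => insert j S = S').card / (growCands L S).card)
    + (if (growCands L S).Nonempty then (1 : ℝ) / 2 else 1) *
      (((pruneCands S).filter fun j => S.erase j = S').card / (pruneCands S).card)

/-! ## Metropolis–Hastings machinery -/

/-- The Metropolis–Hastings transition matrix on `𝕋_L` with target `π₀` and proposal `q`. -/
def mhTrans (L : ℕ) (π₀ : Finset ℕ → ℝ) (q : Finset ℕ → Finset ℕ → ℝ)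
    (S S' : Finset ℕ) : ℝ :=
  if S' = S then
    1 - ∑ T ∈ (trees L).erase S, q S T * min 1 ((π₀ T * q T S) / (π₀ S * q S T))
  else q S S' * min 1 ((π₀ S' * q S' S) / (π₀ S * q S S'))

/-- The lazy modification `(P + I)/2` of a transition matrix. -/
def lazy (P : Finset ℕ → Finset ℕ → ℝ) (S S' : Finset ℕ) : ℝ :=
  (1 / 2) * P S S' + if S' = S then 1 / 2 else 0

/-- `t`-step transition probabilities over the state space `𝕋_L`. -/
def iterP (L : ℕ) (P : Finset ℕ → Finset ℕ → ℝ) : ℕ → Finset ℕ → Finset ℕ → ℝ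
  | 0, S, S' => if S' = S then 1 else 0
  | t + 1, S, S' => ∑ T ∈ trees L, iterP L P t S T * P T S'

/-- Total variation distance `‖P^t(S, ·) − Π(· ∣ Y)‖_TV` between the chain at time `t`
started at `S` and the posterior. -/
def tvDist (L n : ℕ) (p : ℝ) (Y : Fin n → ℝ) (P : Finset ℕ → Finset ℕ → ℝ)
    (t : ℕ) (S : Finset ℕ) : ℝ :=
  (1 / 2) * ∑ T ∈ trees L, |iterP L P t S T - post L n p Y T|

/-- The `ε`-mixing time `τ_ε = max_{𝒯 ∈ 𝕋_L} min{t : Δ_𝒯(t') ≤ ε for all t' ≥ t}`. -/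
def mixTime (L n : ℕ) (p : ℝ) (Y : Fin n → ℝ) (P : Finset ℕ → Finset ℕ → ℝ) (ε : ℝ) : ℕ :=
  sInf {t | ∀ t' ≥ t, ∀ S ∈ trees L, tvDist L n p Y P t' S ≤ ε}

/-- The (non-lazy) Bayesian CART Metropolis–Hastings transition matrix. -/
def bcartP (L n : ℕ) (c : ℝ) (Y : Fin n → ℝ) : Finset ℕ → Finset ℕ → ℝ :=
  mhTrans L (post L n (splitP n c) Y) (bcartProp L)

end BayesCART
namespace BayesCART

/-! ## Twigs and the Twiggy proposal -/

/-- `isAnc a b`: node `a` is a strict ancestor of node `b`. -/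
def isAnc (a b : ℕ) : Prop := ∃ t ∈ Finset.Icc 1 b, b / 2 ^ t = a

instance (a b : ℕ) : Decidable (isAnc a b) := by unfold isAnc; infer_instance

/-- All nodes on the ancestral path from node `j` up to the root (including `j`). -/
def ancPath (j : ℕ) : Finset ℕ := (Finset.range (j + 1)).image fun t => j / 2 ^ t

/-- The tree obtained from `S` by growing, from the closest external node,
the twig ending at the node `j`: the smallest tree containing `S ∪ {j}`. -/
def growTwig (S : Finset ℕ) (j : ℕ) : Finset ℕ := S ∪ ancPath j

/-- The internal descendants of `j` inside the tree `S`. -/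
def descIn (S : Finset ℕ) (j : ℕ) : Finset ℕ := S.filter fun m => isAnc j m

/-- Twiggy PRUNE candidates: non-root internal nodes whose internal descendants
form a twig (a chain in the ancestry order). -/
def twigPruneCands (S : Finset ℕ) : Finset ℕ :=
  S.filter fun j => j ≠ 0 ∧
    ∀ a ∈ descIn S j, ∀ b ∈ descIn S j, a = b ∨ isAnc a b ∨ isAnc b a

/-- The tree obtained by the Twiggy PRUNE at `j`: remove `j` and all of its descendants. -/
def pruneTwig (S : Finset ℕ) (j : ℕ) : Finset ℕ := S \ insert j (descIn S j)

/-- Nodes of layer (depth) `l` missing from `S`. -/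
def layerNodes (S : Finset ℕ) (l : ℕ) : Finset ℕ :=
  (Finset.Ico (2 ^ l) (2 ^ (l + 1))).filter fun j => j ∉ S

/-- Probability `d_{l} = D^{-l} / Σ_{l' ∈ E} D^{-l'}` of picking layer `l` among the
eligible layers. -/
def layerWt (D : ℝ) (L : ℕ) (S : Finset ℕ) (l : ℕ) : ℝ :=
  D ^ (-(l : ℝ)) /
    ∑ l' ∈ (Finset.range L).filter (fun l' => (layerNodes S l').Nonempty), D ^ (-(l' : ℝ))

/-- The Twiggy Bayesian CART proposal kernel: GROW picks a layer with probability
`∝ D^{-l}` then a missing node uniformly within the layer and attaches the whole twig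
to it; PRUNE removes a uniformly chosen twig. -/
def twiggyProp (L : ℕ) (D : ℝ) (S S' : Finset ℕ) : ℝ :=
  (if (twigPruneCands S).Nonempty then (1 : ℝ) / 2 else 1) *
      ∑ l ∈ Finset.range L, layerWt D L S l *
        (((layerNodes S l).filter fun j => growTwig S j = S').card / (layerNodes S l).card)
    + (if ∃ l ∈ Finset.range L, (layerNodes S l).Nonempty then (1 : ℝ) / 2 else 1) *
      (((twigPruneCands S).filter fun j => pruneTwig S j = S').card / (twigPruneCands S).card)

/-- The (non-lazy) Twiggy Bayesian CART Metropolis–Hastings transition matrix. -/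
def twiggyP (L n : ℕ) (c D : ℝ) (Y : Fin n → ℝ) : Finset ℕ → Finset ℕ → ℝ :=
  mhTrans L (post L n (splitP n c) Y) (twiggyProp L D)

/-! ## Locally informed (LIT-MH) proposals -/

/-- GROW neighborhood `𝒩_g(𝒯)` of Bayesian CART: one extra internal node. -/
def bNg (L : ℕ) (S : Finset ℕ) : Finset (Finset ℕ) :=
  (growCands L S).image fun j => insert j S

/-- PRUNE neighborhood `𝒩_p(𝒯)` of Bayesian CART: one internal node removed. -/
def bNp (S : Finset ℕ) : Finset (Finset ℕ) := (pruneCands S).image fun j => S.erase j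

/-- GROW neighborhood of Twiggy Bayesian CART: one extra twig. -/
def tNg (L : ℕ) (S : Finset ℕ) : Finset (Finset ℕ) :=
  (((Finset.range (2 ^ L)).filter fun j => j ∉ S)).image fun j => growTwig S j

/-- PRUNE neighborhood of Twiggy Bayesian CART: one twig removed. -/
def tNp (S : Finset ℕ) : Finset (Finset ℕ) := (twigPruneCands S).image fun j => pruneTwig S j

/-- The posterior ratio `B(𝒯, 𝒯̃) = Π(𝒯̃|Y)/Π(𝒯|Y)`. -/
def postRatio (L n : ℕ) (c : ℝ) (Y : Fin n → ℝ) (S S' : Finset ℕ) : ℝ :=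
  post L n (splitP n c) Y S' / post L n (splitP n c) Y S

/-- Informed GROW weight `w_g(𝒯̃|𝒯) = min{Π(𝒯̃|Y)/Π(𝒯|Y), n^{(A² log n)/8}}`. -/
def wg (L n : ℕ) (c A : ℝ) (Y : Fin n → ℝ) (S S' : Finset ℕ) : ℝ :=
  min (postRatio L n c Y S S') ((n : ℝ) ^ ((A ^ 2 * Real.log n) / 8))

/-- Informed PRUNE weight `w_p(𝒯̃|𝒯) = max{1, min{Π(𝒯̃|Y)/Π(𝒯|Y), n^{c−3/2}}}`. -/
def wp (L n : ℕ) (c : ℝ) (Y : Fin n → ℝ) (S S' : Finset ℕ) : ℝ :=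
  max 1 (min (postRatio L n c Y S S') ((n : ℝ) ^ (c - 3 / 2)))

/-- Normalizing constant `Z_g(𝒯)` of the informed GROW proposal. -/
def Zg (L n : ℕ) (c A : ℝ) (Y : Fin n → ℝ) (Ng : Finset ℕ → Finset (Finset ℕ))
    (S : Finset ℕ) : ℝ := ∑ T ∈ Ng S, wg L n c A Y S T

/-- Normalizing constant `Z_p(𝒯)` of the informed PRUNE proposal. -/
def Zp (L n : ℕ) (c : ℝ) (Y : Fin n → ℝ) (Np : Finset ℕ → Finset (Finset ℕ))
    (S : Finset ℕ) : ℝ := ∑ T ∈ Np S, wp L n c Y S T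

/-- The locally informed (LIT-MH) proposal with neighborhoods `Ng`, `Np`. -/
def infProp (L n : ℕ) (c A : ℝ) (Y : Fin n → ℝ)
    (Ng Np : Finset ℕ → Finset (Finset ℕ)) (S S' : Finset ℕ) : ℝ :=
  (1 / 2) * (if S' ∈ Ng S then wg L n c A Y S S' / Zg L n c A Y Ng S else 0)
    + (1 / 2) * (if S' ∈ Np S then wp L n c Y S S' / Zp L n c Y Np S else 0)

/-- The informed Bayesian CART Metropolis–Hastings transition matrix. -/
def infBcartP (L n : ℕ) (c A : ℝ) (Y : Fin n → ℝ) : Finset ℕ → Finset ℕ → ℝ :=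
  mhTrans L (post L n (splitP n c) Y) (infProp L n c A Y (bNg L) bNp)

/-- The informed Twiggy Bayesian CART Metropolis–Hastings transition matrix. -/
def infTwiggyP (L n : ℕ) (c A : ℝ) (Y : Fin n → ℝ) : Finset ℕ → Finset ℕ → ℝ :=
  mhTrans L (post L n (splitP n c) Y) (infProp L n c A Y (tNg L) tNp)

/-! ## Drift functions -/

/-- The first drift function
`V₁(𝒯) = exp{(2^L (C+2)² (n+1))^{-1} · Y'(I − P_𝒯/n)Y}`, where
`Y' P_𝒯 Y = Σ_{j ∈ 𝒯_int} (X_j'Y)²` for the orthogonal Haar design. -/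
def V1 (L n : ℕ) (C : ℝ) (Y : Fin n → ℝ) (S : Finset ℕ) : ℝ :=
  Real.exp ((1 / (2 ^ L * (C + 2) ^ 2 * ((n : ℝ) + 1))) *
    ((∑ i, Y i ^ 2) - (1 / (n : ℝ)) * ∑ j ∈ S, colDot n Y j ^ 2))

/-- The second drift function
`V₂(𝒯) = exp{2^{-L}(|𝒯_int ∖ 𝒯*_int| + min(|𝒯*_int ∖ 𝒯_int|,1)·(2^L − |𝒯_int ∪ 𝒯*_int|))}`. -/
def V2 (L : ℕ) (Sstar S : Finset ℕ) : ℝ :=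
  Real.exp ((1 / 2 ^ L) * (((S \ Sstar).card : ℝ) +
    min (((Sstar \ S).card : ℝ)) 1 * ((2 ^ L : ℝ) - ((S ∪ Sstar).card : ℝ))))

/-- Drift ratio `R(𝒯, 𝒯̃) = V(𝒯̃)/V(𝒯) − 1`. -/
def driftR (V : Finset ℕ → ℝ) (S S' : Finset ℕ) : ℝ := V S' / V S - 1

/-- `(PV)(𝒯) = Σ_{𝒯̃ ∈ 𝕋_L} V(𝒯̃) P(𝒯, 𝒯̃)`. -/
def PV (L : ℕ) (P : Finset ℕ → Finset ℕ → ℝ) (V : Finset ℕ → ℝ) (S : Finset ℕ) : ℝ :=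
  ∑ T ∈ trees L, V T * P S T

/-! ## Canonical paths -/

/-- The Bayesian CART canonical transition map `𝒢` toward `𝒯*`: if the tree has
redundant internal nodes, remove the deepest rightmost one (maximal `j = 2^l + k`);
otherwise (when `𝒯 ⊂ 𝒯*`) add the deepest rightmost external node lying in `𝒯*_int`. -/
def gMap (Sstar S : Finset ℕ) : Finset ℕ :=
  if S = Sstar then S
  else
    match (S \ Sstar).max with
    | some j => S.erase j
    | none =>
      match ((extSet S) ∩ Sstar).max with
      | some j => insert j S
      | none => S

/-- The Twiggy canonical transition map toward `𝒯*`: if the tree has redundant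
internal nodes, remove the shallowest leftmost one whose internal descendants form a
twig, together with its whole twig of descendants; otherwise grow the twig toward the
deepest rightmost node of `𝒯*_int` missing from `𝒯`. -/
def gTwig (Sstar S : Finset ℕ) : Finset ℕ :=
  if S = Sstar then S
  else
    match ((S \ Sstar).filter fun j =>
        ∀ a ∈ descIn S j, ∀ b ∈ descIn S j, a = b ∨ isAnc a b ∨ isAnc b a).min with
    | some j => pruneTwig S j
    | none =>
      match (Sstar \ S).max with
      | some j => growTwig S j
      | none => S

/-- The set of states on the canonical path from `S` to `𝒯*` (iterating the
transition map `g`; `g` fixes `𝒯*`, and the fuel `2^(2L+2)` is ample). -/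
def pathStates (L : ℕ) (g : Finset ℕ → Finset ℕ) (S : Finset ℕ) : Finset (Finset ℕ) :=
  (Finset.range (2 ^ (2 * L + 2) + 1)).image fun t => g^[t] S

/-- The length `|T_{𝒯,𝒯'}|` of the collapsed canonical path between `𝒯` and `𝒯'`:
the number of states of either path to `𝒯*` that are not on the other path. -/
def pathLen (L : ℕ) (g : Finset ℕ → Finset ℕ) (S S' : Finset ℕ) : ℕ :=
  (pathStates L g S \ pathStates L g S').card + (pathStates L g S' \ pathStates L g S).card

/-- The directed edges traversed by the canonical path from `S` to `𝒯*`. -/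
def pathEdges (L : ℕ) (g : Finset ℕ → Finset ℕ) (S : Finset ℕ) :
    Finset (Finset ℕ × Finset ℕ) :=
  ((Finset.range (2 ^ (2 * L + 2))).image fun t => (g^[t] S, g^[t + 1] S)).filter
    fun e => e.1 ≠ e.2

/-- The edge `e` lies on the collapsed canonical path `T_{𝒯,𝒯'}` (in the forward
direction along `T_{𝒯,𝒯*}`, or backward along `T_{𝒯',𝒯*}`), the common portion of
the two paths being removed. -/
def onPath (L : ℕ) (g : Finset ℕ → Finset ℕ) (e : Finset ℕ × Finset ℕ)
    (S S' : Finset ℕ) : Prop :=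
  (e ∈ pathEdges L g S ∧ e ∉ pathEdges L g S') ∨
    (e.swap ∈ pathEdges L g S' ∧ e.swap ∉ pathEdges L g S)

instance (L : ℕ) (g : Finset ℕ → Finset ℕ) (e : Finset ℕ × Finset ℕ) (S S' : Finset ℕ) :
    Decidable (onPath L g e S S') := by unfold onPath; infer_instance

end BayesCART

namespace BayesCART

/-! ## Orthogonality of the Haar design

With `n = 2 ^ (M + 1)`, the observation `i` is the leaf `i + n` of the dyadic tree, and its
ancestor at depth `l + 1` is `(i + n) / 2 ^ (M - l)`. -/

/-- In heap indexing, `ψ_j` is positive at the leaves below `2j` and negative at those below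
`2j + 1`. -/
lemma haarCol_eq {n m j : ℕ} (hm : 0 < m) (hj : j ≠ 0) (hn : n = 2 ^ (Nat.log 2 j + 1) * m)
    (i : ℕ) :
    haarCol n j i = (2 : ℝ) ^ ((Nat.log 2 j : ℝ) / 2) *
      ((if (i + n) / m = 2 * j then 1 else 0) - (if (i + n) / m = 2 * j + 1 then 1 else 0)) := by
  set l := Nat.log 2 j with hl
  have hlj : 2 ^ l ≤ j := Nat.pow_log_le_self 2 hj
  obtain ⟨k, hk⟩ := Nat.exists_eq_add_of_le hlj
  have hmR : (0 : ℝ) < m := by exact_mod_cast hm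
  have hx : (2 : ℝ) ^ l * ((i + 1 : ℝ) / n) - ((j - 2 ^ l : ℕ) : ℝ)
      = ((i + 1 : ℕ) - (2 * k * m : ℕ) : ℝ) / (2 * m) := by
    have : j - 2 ^ l = k := by omega
    rw [this, hn, pow_succ]
    push_cast
    field_simp
  have e1 : (i + n) / m = 2 * j ↔ 2 * k * m ≤ i ∧ i < 2 * k * m + m := by
    rw [Nat.div_eq_iff hm, hn, hk]
    ring_nf
    omega
  have e2 : (i + n) / m = 2 * j + 1 ↔ 2 * k * m + m ≤ i ∧ i < 2 * k * m + 2 * m := by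
    rw [Nat.div_eq_iff hm, hn, hk]
    ring_nf
    omega
  have h0 : 0 < ((i + 1 : ℕ) - (2 * k * m : ℕ) : ℝ) / (2 * m) ↔ 2 * k * m ≤ i := by
    rw [div_pos_iff_of_pos_right (by positivity), sub_pos, Nat.cast_lt, Nat.lt_succ_iff]
  have h1 : ((i + 1 : ℕ) - (2 * k * m : ℕ) : ℝ) / (2 * m) ≤ 1 / 2 ↔ i < 2 * k * m + m := by
    rw [div_le_iff₀ (by positivity), sub_le_iff_le_add]
    rw [show 1 / 2 * (2 * (m : ℝ)) + (2 * k * m : ℕ) = ((2 * k * m + m : ℕ) : ℝ) by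
      push_cast; ring, Nat.cast_le, Nat.succ_le_iff]
  have h2 : ((i + 1 : ℕ) - (2 * k * m : ℕ) : ℝ) / (2 * m) ≤ 1 ↔ i < 2 * k * m + 2 * m := by
    rw [div_le_iff₀ (by positivity), sub_le_iff_le_add]
    rw [show 1 * (2 * (m : ℝ)) + (2 * k * m : ℕ) = ((2 * k * m + 2 * m : ℕ) : ℝ) by
      push_cast; ring, Nat.cast_le, Nat.succ_le_iff]
  rw [haarCol, if_neg hj, ← hl, hx, haarMother]
  congr 1
  simp only [← not_le (a := _ / (2 * (m : ℝ))) (b := 1 / 2), h0, h1, h2, e1, e2]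
  split_ifs <;> first | omega | norm_num

lemma sum_block_indicator {n m q : ℕ} (hm : 0 < m) (h1 : n ≤ q * m) (h2 : (q + 1) * m ≤ 2 * n) :
    ∑ i ∈ range n, (if (i + n) / m = q then (1 : ℝ) else 0) = m := by
  rw [← sum_filter, sum_const, nsmul_one, Nat.cast_inj]
  have : ((range n).filter fun i => (i + n) / m = q) = Ico (q * m - n) (q * m - n + m) := by
    ext i
    rw [mem_filter, mem_range, mem_Ico, Nat.div_eq_iff hm]
    rw [add_mul, one_mul] at h2
    omega
  rw [this, Nat.card_Ico]
  omega

/-- A function that is constant on the dyadic support of `ψ_j` is orthogonal to `ψ_j`. -/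
lemma sum_mul_haarCol_eq_zero {n m j : ℕ} (hm : 0 < m) (hj : j ≠ 0)
    (hn : n = 2 ^ (Nat.log 2 j + 1) * m) (G : ℕ → ℝ) :
    ∑ i ∈ range n, G ((i + n) / (2 * m)) * haarCol n j i = 0 := by
  have hlo : 2 ^ Nat.log 2 j * m ≤ j * m := Nat.mul_le_mul_right _ (Nat.pow_log_le_self 2 hj)
  have hhi : (j + 1) * m ≤ 2 ^ (Nat.log 2 j + 1) * m :=
    Nat.mul_le_mul_right _ (Nat.lt_pow_succ_log_self one_lt_two j)
  have key : ∀ i, G ((i + n) / (2 * m)) * haarCol n j i =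
      G j * (2 : ℝ) ^ ((Nat.log 2 j : ℝ) / 2) *
        ((if (i + n) / m = 2 * j then 1 else 0) -
          (if (i + n) / m = 2 * j + 1 then 1 else 0)) := by
    intro i
    rw [haarCol_eq hm hj hn, mul_comm 2 m, ← Nat.div_div_eq_div_mul]
    split_ifs with h h' h'
    · omega
    · rw [show (i + n) / m / 2 = j by omega]; ring
    · rw [show (i + n) / m / 2 = j by omega]; ring
    · simp
  rw [pow_succ] at hn hhi
  simp_rw [key]
  rw [← mul_sum, sum_sub_distrib, sum_block_indicator hm (by nlinarith) (by nlinarith),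
    sum_block_indicator hm (by nlinarith) (by nlinarith), sub_self, mul_zero]

lemma sum_haarCol_sq {M n j : ℕ} (hn : n = 2 ^ (M + 1)) (hj : j < 2 ^ M) :
    ∑ i ∈ range n, haarCol n j i ^ 2 = n := by
  rcases eq_or_ne j 0 with rfl | hj0
  · simp [haarCol]
  set l := Nat.log 2 j with hl
  have hlM : l < M := Nat.log_lt_of_lt_pow hj0 hj
  have hn' : n = 2 ^ (l + 1) * 2 ^ (M - l) := by
    rw [hn, ← pow_add]; congr 1; omega
  set m := 2 ^ (M - l)
  have hm : 0 < m := by positivity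
  have hlo : 2 ^ l * m ≤ j * m := Nat.mul_le_mul_right _ (Nat.pow_log_le_self 2 hj0)
  have hhi : (j + 1) * m ≤ 2 ^ (l + 1) * m :=
    Nat.mul_le_mul_right _ (Nat.lt_pow_succ_log_self one_lt_two j)
  have key : ∀ i, haarCol n j i ^ 2 = (2 : ℝ) ^ l *
      ((if (i + n) / m = 2 * j then 1 else 0) +
        (if (i + n) / m = 2 * j + 1 then 1 else 0)) := by
    intro i
    rw [haarCol_eq hm hj0 hn', mul_pow, ← Real.rpow_natCast (_ ^ _) 2,
      ← Real.rpow_mul zero_le_two, ← Real.rpow_natCast 2 l, ← hl]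
    congr 1
    · congr 1; push_cast; ring
    · split_ifs <;> first | omega | norm_num
  simp_rw [key]
  have hn'' : n = 2 ^ l * 2 * m := by rw [hn', pow_succ]
  rw [pow_succ] at hhi
  rw [← mul_sum, sum_add_distrib, sum_block_indicator hm (by nlinarith) (by nlinarith),
    sum_block_indicator hm (by nlinarith) (by nlinarith), hn'']
  push_cast
  ring

lemma sum_haarCol_mul_eq_zero_of_lt {M n j k : ℕ} (hn : n = 2 ^ (M + 1)) (hj : j < 2 ^ M)
    (hkj : k < j) : ∑ i ∈ range n, haarCol n k i * haarCol n j i = 0 := by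
  have hj0 : j ≠ 0 := by omega
  have hn' : ∀ a, a < 2 ^ M → a ≠ 0 → n = 2 ^ (Nat.log 2 a + 1) * 2 ^ (M - Nat.log 2 a) := by
    intro a ha ha0
    have := Nat.log_lt_of_lt_pow ha0 ha
    rw [hn, ← pow_add]; congr 1; omega
  have hlM : Nat.log 2 j < M := Nat.log_lt_of_lt_pow hj0 hj
  rcases eq_or_ne k 0 with rfl | hk0
  · simpa [haarCol] using sum_mul_haarCol_eq_zero (by positivity) hj0 (hn' j hj hj0) fun _ => 1
  rcases (Nat.log_mono_right hkj.le : Nat.log 2 k ≤ Nat.log 2 j).eq_or_lt with heq | hlt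
  · refine sum_eq_zero fun i _ => ?_
    have hm : 0 < 2 ^ (M - Nat.log 2 j) := by positivity
    have hnk := hn' k (hkj.trans hj) hk0
    rw [heq] at hnk
    rw [haarCol_eq hm hj0 (hn' j hj hj0), haarCol_eq hm hk0 (by rw [heq]; exact hnk)]
    split_ifs <;> first | omega | simp
  · set lk := Nat.log 2 k with hlk
    set lj := Nat.log 2 j with hlj
    have hfac : 2 ^ (M - lk) = 2 * 2 ^ (M - lj) * 2 ^ (lj - lk - 1) := by
      rw [← pow_succ', ← pow_add]; congr 1; omega
    have := sum_mul_haarCol_eq_zero (by positivity) hj0 (hn' j hj hj0) fun a =>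
      (2 : ℝ) ^ ((lk : ℝ) / 2) * ((if a / 2 ^ (lj - lk - 1) = 2 * k then 1 else 0) -
        (if a / 2 ^ (lj - lk - 1) = 2 * k + 1 then 1 else 0))
    rw [← this]
    refine sum_congr rfl fun i _ => ?_
    rw [haarCol_eq (by positivity) hk0 (hn' k (hkj.trans hj) hk0) i]
    simp only [← hlk, ← hlj, hfac, Nat.div_div_eq_div_mul]

lemma sum_haarCol_mul_haarCol {M n j k : ℕ} (hn : n = 2 ^ (M + 1)) (hj : j < 2 ^ M)
    (hk : k < 2 ^ M) :
    ∑ i ∈ range n, haarCol n j i * haarCol n k i = if j = k then (n : ℝ) else 0 := by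
  rcases lt_trichotomy j k with h | rfl | h
  · rw [if_neg h.ne, sum_haarCol_mul_eq_zero_of_lt hn hk h]
  · simpa [sq] using sum_haarCol_sq hn hj
  · rw [if_neg h.ne', ← sum_haarCol_mul_eq_zero_of_lt hn hj h]
    exact sum_congr rfl fun i _ => mul_comm _ _

/-- `X_j' Y = n β_j + X_j' ε`. -/
lemma colDot_Yvec {M n j : ℕ} (hn : n = 2 ^ (M + 1)) (hj : j < 2 ^ M) {β : ℕ → ℝ}
    {B : Finset ℕ} (hB : ∀ k ∈ B, k < 2 ^ M) (hβ : ∀ k, k ∉ B → β k = 0) (ε : Fin n → ℝ) :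
    colDot n (Yvec n β B ε) j = n * β j + colDot n ε j := by
  have hsig : ∑ i : Fin n, haarCol n j i * signalVec n β B i = n * β j := by
    calc ∑ i : Fin n, haarCol n j i * signalVec n β B i
        = ∑ k ∈ B, β k * ∑ i ∈ range n, haarCol n j i * haarCol n k i := by
          simp only [signalVec, mul_sum]
          rw [sum_comm]
          refine sum_congr rfl fun k _ => ?_
          rw [← Fin.sum_univ_eq_sum_range (fun i => β k * (haarCol n j i * haarCol n k i))]
          exact sum_congr rfl fun i _ => by ring
      _ = ∑ k ∈ B, if j = k then n * β j else 0 := by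
          refine sum_congr rfl fun k hk => ?_
          rw [sum_haarCol_mul_haarCol hn hj (hB k hk)]
          split_ifs with h
          · rw [h, mul_comm]
          · rw [mul_zero]
      _ = n * β j := by
          rw [sum_ite_eq]
          split_ifs with h
          · rfl
          · rw [hβ j h, mul_zero]
  simp only [colDot, Yvec, mul_add, sum_add_distrib, hsig]

/-! ## Gaussian noise -/

lemma hasSubgaussianMGF_colDot (n j : ℕ) (v : ℝ≥0)
    (hv : ∑ i ∈ range n, haarCol n j i ^ 2 = v) :
    ProbabilityTheory.HasSubgaussianMGF (fun ε => colDot n ε j) v (gauss n) := by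
  have hid : ProbabilityTheory.HasSubgaussianMGF id 1 (ProbabilityTheory.gaussianReal 0 1) :=
    { integrable_exp_mul := fun t => ProbabilityTheory.integrable_exp_mul_gaussianReal t
      mgf_le := fun t => by simp [ProbabilityTheory.mgf_id_gaussianReal] }
  have hcoord : ∀ i : Fin n, ProbabilityTheory.HasSubgaussianMGF
      (fun ε : Fin n → ℝ => ε i) 1 (gauss n) := fun i => by
    have hmp : MeasurePreserving (fun ε : Fin n → ℝ => ε i) (gauss n)
        (ProbabilityTheory.gaussianReal 0 1) := measurePreserving_eval _ i
    exact .of_map (X := id) hmp.measurable.aemeasurable (by rwa [hmp.map_eq])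
  have hind : ProbabilityTheory.iIndepFun (fun (i : Fin n) (ε : Fin n → ℝ) =>
      haarCol n j i * ε i) (gauss n) :=
    ProbabilityTheory.iIndepFun_pi (X := fun (i : Fin n) x => haarCol n j i * x) fun i => by fun_prop
  have := ProbabilityTheory.HasSubgaussianMGF.sum_of_iIndepFun hind (s := univ)
    fun i _ => (hcoord i).const_mul (haarCol n j i)
  convert! this using 1
  apply NNReal.coe_injective
  rw [← hv, ← Fin.sum_univ_eq_sum_range (fun i => haarCol n j i ^ 2)]
  rw [NNReal.coe_sum]
  exact sum_congr rfl fun i _ => (mul_one (haarCol n j i ^ 2)).symm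

lemma gauss_abs_colDot_gt_le {n j : ℕ}
    (hsq : ∑ i ∈ range n, haarCol n j i ^ 2 = n) {t : ℝ} (ht : 0 ≤ t) :
    (gauss n).real {ε | t < |colDot n ε j|} ≤ 2 * Real.exp (-t ^ 2 / (2 * n)) := by
  have : IsProbabilityMeasure (gauss n) := by unfold gauss; infer_instance
  have h := hasSubgaussianMGF_colDot n j n (by simpa using hsq)
  have h1 := h.measure_ge_le ht
  have h2 := h.neg.measure_ge_le ht
  calc (gauss n).real {ε | t < |colDot n ε j|}
      ≤ (gauss n).real ({ε | t ≤ colDot n ε j} ∪ {ε | t ≤ -colDot n ε j}) :=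
        measureReal_mono fun ε (hε : t < |colDot n ε j|) => le_abs.1 hε.le
    _ ≤ _ := measureReal_union_le _ _
    _ ≤ _ := by
        rw [two_mul]
        exact add_le_add (by simpa using h1) (by simpa using h2)

/-- All the noise coefficients are below `√(4 n log n)` with probability at least `1 - 1/n`. -/
lemma le_gauss_noise_event {M n : ℕ} (hn : n = 2 ^ (M + 1)) :
    ENNReal.ofReal (1 - 1 / n) ≤
      gauss n {ε | ∀ j < 2 ^ M, |colDot n ε j| ≤ √(4 * n * Real.log n)} := by
  have : IsProbabilityMeasure (gauss n) := by unfold gauss; infer_instance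
  have hn2 : 2 ≤ n := by rw [hn]; exact Nat.le_self_pow (by omega) 2
  have hnR : (0 : ℝ) < n := by positivity
  have hlog : 0 ≤ Real.log n := Real.log_natCast_nonneg n
  set t := √(4 * n * Real.log n) with ht
  have hmeas : MeasurableSet {ε : Fin n → ℝ | ∀ j < 2 ^ M, |colDot n ε j| ≤ t} := by
    simp only [colDot, Set.ofPred_forall]
    refine MeasurableSet.iInter fun j => MeasurableSet.iInter fun _ => ?_
    exact measurableSet_le (by fun_prop) measurable_const
  have hcompl : {ε : Fin n → ℝ | ∀ j < 2 ^ M, |colDot n ε j| ≤ t}ᶜ =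
      ⋃ j ∈ range (2 ^ M), {ε | t < |colDot n ε j|} := by
    ext ε; simp
  have hexp : Real.exp (-t ^ 2 / (2 * n)) = 1 / (n : ℝ) ^ 2 := by
    rw [ht, Real.sq_sqrt (by positivity),
      show -(4 * n * Real.log n) / (2 * n) = -(Real.log n * (2 : ℕ)) by push_cast; field_simp; ring,
      Real.exp_neg, Real.exp_mul, Real.exp_log hnR, Real.rpow_natCast, one_div]
  have hle : (gauss n).real {ε : Fin n → ℝ | ∀ j < 2 ^ M, |colDot n ε j| ≤ t}ᶜ ≤ 1 / n := by
    rw [hcompl]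
    refine (measureReal_biUnion_finset_le _ _).trans ?_
    refine (sum_le_sum fun j hj => gauss_abs_colDot_gt_le
      (sum_haarCol_sq hn (mem_range.1 hj)) (Real.sqrt_nonneg _)).trans_eq ?_
    rw [sum_const, card_range, ← ht, hexp, nsmul_eq_mul]
    have : (n : ℝ) = 2 ^ M * 2 := by rw [hn]; push_cast; ring
    push_cast
    rw [this]
    field_simp
  rw [measureReal_compl hmeas, probReal_univ] at hle
  refine ENNReal.ofReal_le_of_le_toReal ?_
  rw [← measureReal_def]
  linarith

/-! ## Trees and their neighborhoods -/

lemma mem_trees {L : ℕ} {S : Finset ℕ} : S ∈ trees L ↔ IsTree L S := by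
  rw [trees, mem_filter, mem_powerset, and_iff_right_iff_imp]
  exact fun h j hj => mem_range.2 (h.2.2 j hj)

lemma card_extSet {L : ℕ} {S : Finset ℕ} (hS : IsTree L S) : (extSet S).card = S.card := by
  set U := (S.image fun j => 2 * j) ∪ S.image fun j => 2 * j + 1 with hU
  have hext : extSet S = U \ S := by ext j; simp [extSet, hU]
  have hdisj : Disjoint (S.image fun j => 2 * j) (S.image fun j => 2 * j + 1) := by
    simp only [disjoint_left, mem_image]
    rintro _ ⟨a, _, rfl⟩ ⟨b, _, h⟩
    omega
  have hcard : U.card = S.card + S.card := by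
    rw [hU, card_union_of_disjoint hdisj, card_image_of_injective, card_image_of_injective]
    all_goals intro a b h; simp only at h; omega
  have hsub : S ⊆ U := by
    intro j hj
    simp only [hU, mem_union, mem_image]
    rcases Nat.eq_zero_or_pos j with rfl | hpos
    · exact .inl ⟨0, hj, rfl⟩
    · have := hS.2.1 j hj hpos
      rcases Nat.even_or_odd' j with ⟨k, h | h⟩
      · exact .inl ⟨j / 2, this, by omega⟩
      · exact .inr ⟨j / 2, this, by omega⟩
  rw [hext, card_sdiff_of_subset hsub, hcard]
  omega

lemma mem_of_div_two_pow {L : ℕ} {S : Finset ℕ} (hS : IsTree L S) {m : ℕ} (hm : m ∈ S)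
    (t : ℕ) : m / 2 ^ t ∈ S := by
  induction t with
  | zero => simpa
  | succ t ih =>
    rw [pow_succ, ← Nat.div_div_eq_div_mul]
    rcases Nat.eq_zero_or_pos (m / 2 ^ t) with h | h
    · simpa [h] using hS.1
    · exact hS.2.1 _ ih h

lemma isAnc_of_div_eq {a b t : ℕ} (ha : a ≠ 0) (ht : 1 ≤ t) (h : b / 2 ^ t = a) :
    isAnc a b := by
  refine ⟨t, mem_Icc.2 ⟨ht, ?_⟩, h⟩
  by_contra! hb
  exact ha (h ▸ Nat.div_eq_of_lt (hb.trans Nat.lt_two_pow_self))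

lemma log_lt_log_of_isAnc {a b : ℕ} (ha : a ≠ 0) (h : isAnc a b) :
    Nat.log 2 a < Nat.log 2 b := by
  obtain ⟨t, ht, rfl⟩ := h
  have hle : 2 ^ (Nat.log 2 (b / 2 ^ t) + t) ≤ b := by
    rw [pow_add]
    exact (Nat.mul_le_mul_right _ (Nat.pow_log_le_self 2 ha)).trans (Nat.div_mul_le_self _ _)
  have := Nat.le_log_of_pow_le one_lt_two hle
  have := (mem_Icc.1 ht).1
  omega

lemma insert_mem_trees {L : ℕ} {S : Finset ℕ} (hS : S ∈ trees L) {j : ℕ}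
    (hj : j ∈ growCands L S) : insert j S ∈ trees L := by
  rw [mem_trees] at hS ⊢
  simp only [growCands, extSet, mem_filter, mem_union, mem_image] at hj
  refine ⟨mem_insert_of_mem hS.1, fun k hk hk1 => mem_insert_of_mem ?_, fun k hk => ?_⟩
  · rcases mem_insert.1 hk with rfl | hk
    · obtain ⟨⟨⟨a, ha, h⟩ | ⟨a, ha, h⟩, -⟩, -⟩ := hj <;>
        rwa [show k / 2 = a by omega]
    · exact hS.2.1 k hk hk1
  · rcases mem_insert.1 hk with rfl | hk
    · exact hj.2
    · exact hS.2.2 k hk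

lemma growTwig_mem_trees {L : ℕ} {S : Finset ℕ} (hS : S ∈ trees L) {j : ℕ} (hj : j < 2 ^ L) :
    growTwig S j ∈ trees L := by
  rw [mem_trees] at hS ⊢
  refine ⟨mem_union_left _ hS.1, fun k hk hk1 => ?_, fun k hk => ?_⟩
  · rcases mem_union.1 hk with hk | hk
    · exact mem_union_left _ (hS.2.1 k hk hk1)
    · obtain ⟨t, ht, rfl⟩ := mem_image.1 hk
      rcases (Nat.lt_succ_iff.1 (mem_range.1 ht)).eq_or_lt with rfl | hlt
      · rw [Nat.div_eq_of_lt Nat.lt_two_pow_self] at hk1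
        omega
      · refine mem_union_right _ (mem_image.2 ⟨t + 1, mem_range.2 (by omega), ?_⟩)
        rw [pow_succ, Nat.div_div_eq_div_mul]
  · rcases mem_union.1 hk with hk | hk
    · exact hS.2.2 k hk
    · obtain ⟨t, -, rfl⟩ := mem_image.1 hk
      exact (Nat.div_le_self _ _).trans_lt hj

lemma pruneTwig_mem_trees {L : ℕ} {S : Finset ℕ} (hS : S ∈ trees L) {j : ℕ} (hj : j ≠ 0) :
    pruneTwig S j ∈ trees L := by
  rw [mem_trees] at hS ⊢
  have hanc0 : ¬ isAnc j 0 := by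
    rintro ⟨t, ht, -⟩
    rw [mem_Icc] at ht
    omega
  refine ⟨?_, fun k hk hk1 => ?_, fun k hk => hS.2.2 k (mem_sdiff.1 hk).1⟩
  · simp [pruneTwig, descIn, hS.1, hj.symm, hanc0]
  · simp only [pruneTwig, descIn, mem_sdiff, mem_insert, mem_filter, not_or, not_and] at hk ⊢
    refine ⟨hS.2.1 k hk.1 hk1, fun h => ?_, fun _ h => ?_⟩
    · exact hk.2.2 hk.1 (isAnc_of_div_eq hj le_rfl (by simpa using h))
    · obtain ⟨t, ht, h⟩ := h
      refine hk.2.2 hk.1 (isAnc_of_div_eq hj (Nat.le_add_left 1 t) ?_)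
      rw [pow_succ', ← Nat.div_div_eq_div_mul, h]

/-- A pre-terminal node is the end of a twig of length one. -/
lemma bNp_subset_tNp {L : ℕ} {S : Finset ℕ} (hS : S ∈ trees L) : bNp S ⊆ tNp S := by
  rw [mem_trees] at hS
  intro S' hS'
  obtain ⟨j, hj, rfl⟩ := mem_image.1 hS'
  simp only [pruneCands, mem_filter] at hj
  obtain ⟨hjS, hj0, h1, h2⟩ := hj
  have hdesc : descIn S j = ∅ := by
    refine filter_eq_empty_iff.2 fun m hm ⟨t, ht, h⟩ => ?_
    obtain ⟨s, rfl⟩ := Nat.exists_eq_add_of_le' (mem_Icc.1 ht).1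
    have hmem := mem_of_div_two_pow hS hm s
    rw [pow_succ, ← Nat.div_div_eq_div_mul] at h
    rcases (by omega : m / 2 ^ s = 2 * j ∨ m / 2 ^ s = 2 * j + 1) with h' | h' <;>
      rw [h'] at hmem <;> contradiction
  refine mem_image.2 ⟨j, ?_, ?_⟩
  · simp [twigPruneCands, hjS, hj0, hdesc]
  · simp [pruneTwig, hdesc, erase_eq]

/-- A twig has at most one node at each depth. -/
lemma card_twig_le {L : ℕ} {S : Finset ℕ} (hS : S ∈ trees L) {j : ℕ}
    (hj : j ∈ twigPruneCands S) : (insert j (descIn S j)).card ≤ L := by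
  rw [mem_trees] at hS
  simp only [twigPruneCands, mem_filter] at hj
  obtain ⟨hjS, hj0, hchain⟩ := hj
  have hdesc : ∀ a ∈ descIn S j, isAnc j a := fun a ha => (mem_filter.1 ha).2
  have hne : ∀ a ∈ insert j (descIn S j), a ≠ 0 := by
    intro a ha h0
    rcases mem_insert.1 ha with rfl | ha
    · exact hj0 h0
    · have := log_lt_log_of_isAnc hj0 (hdesc a ha)
      simp [h0] at this
  have hcmp : ∀ a ∈ insert j (descIn S j), ∀ b ∈ insert j (descIn S j),
      a = b ∨ isAnc a b ∨ isAnc b a := by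
    intro a ha b hb
    rcases mem_insert.1 ha with rfl | ha <;> rcases mem_insert.1 hb with rfl | hb
    · exact .inl rfl
    · exact .inr (.inl (hdesc b hb))
    · exact .inr (.inr (hdesc a ha))
    · exact hchain a ha b hb
  have hinj : Set.InjOn (Nat.log 2) (insert j (descIn S j) : Finset ℕ) := by
    intro a ha b hb hab
    rcases hcmp a ha b hb with h | h | h
    · exact h
    · exact absurd hab (log_lt_log_of_isAnc (hne a ha) h).ne
    · exact absurd hab (log_lt_log_of_isAnc (hne b hb) h).ne'
  rw [← card_image_of_injOn hinj]
  refine (card_le_card (t := range L) fun l hl => ?_).trans_eq (card_range L)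
  obtain ⟨a, ha, rfl⟩ := mem_image.1 hl
  have haS : a ∈ S := by
    rcases mem_insert.1 ha with rfl | ha
    · exact hjS
    · exact (mem_filter.1 ha).1
  exact mem_range.2 (Nat.log_lt_of_lt_pow (hne a ha) (hS.2.2 a haS))

/-- Every GROW neighbor, by a node or by a twig, is a strictly larger tree. -/
lemma ssubset_of_mem_grow {L : ℕ} {S S' : Finset ℕ} (hS : S ∈ trees L)
    (hS' : S' ∈ bNg L S ∪ tNg L S) : S' ∈ trees L ∧ S ⊂ S' := by
  rcases mem_union.1 hS' with h | h
  · obtain ⟨j, hj, rfl⟩ := mem_image.1 h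
    refine ⟨insert_mem_trees hS hj, ssubset_insert ?_⟩
    exact (mem_filter.1 (mem_filter.1 hj).1).2
  · obtain ⟨j, hj, rfl⟩ := mem_image.1 h
    simp only [mem_filter, mem_range] at hj
    refine ⟨growTwig_mem_trees hS hj.1,
      Finset.ssubset_iff_subset_ne.2 ⟨subset_union_left, fun h => ?_⟩⟩
    refine hj.2 (h ▸ mem_union_right _ (mem_image.2 ⟨0, by simp, by simp⟩))

/-- Every PRUNE neighbor is a strictly smaller tree, with at most `L` nodes removed. -/
lemma ssubset_of_mem_prune {L : ℕ} {S S' : Finset ℕ} (hS : S ∈ trees L)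
    (hS' : S' ∈ bNp S ∪ tNp S) : S' ∈ trees L ∧ S' ⊂ S ∧ (S \ S').card ≤ L := by
  rw [union_eq_right.2 (bNp_subset_tNp hS)] at hS'
  obtain ⟨j, hj, rfl⟩ := mem_image.1 hS'
  have hj' := (mem_filter.1 hj)
  refine ⟨pruneTwig_mem_trees hS hj'.2.1,
    Finset.ssubset_iff_subset_ne.2 ⟨sdiff_subset, fun h => ?_⟩, ?_⟩
  · have := h ▸ hj'.1
    simp [pruneTwig] at this
  · refine (card_le_card ?_).trans (card_twig_le hS hj)
    rw [pruneTwig, sdiff_sdiff_right_self]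
    exact inter_subset_right

lemma card_grow_le {L : ℕ} (S : Finset ℕ) :
    (bNg L S).card ≤ 2 ^ L ∧ (tNg L S).card ≤ 2 ^ L := by
  have hr := card_range (2 ^ L)
  constructor <;> refine card_image_le.trans (le_of_le_of_eq (card_le_card ?_) hr)
  · exact fun j hj => mem_range.2 (mem_filter.1 hj).2
  · exact filter_subset _ _

/-! ## Posterior ratios as products over nodes -/

/-- The multiplicative contribution of an internal node to the posterior. -/
def nodeWt (n : ℕ) (c : ℝ) (Y : Fin n → ℝ) (j : ℕ) : ℝ :=
  splitP n c * (1 - splitP n c) * (1 + n : ℝ) ^ (-(1 : ℝ) / 2) *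
    Real.exp (colDot n Y j ^ 2 / (2 * (n + 1)))

lemma splitP_bounds {n : ℕ} {c : ℝ} (hn : 2 ≤ n) (hc : 1 ≤ c) :
    0 < splitP n c ∧ splitP n c ≤ 1 / 2 := by
  have hn' : (2 : ℝ) ≤ n := by exact_mod_cast hn
  refine ⟨Real.rpow_pos_of_pos (by linarith) _, ?_⟩
  calc (n : ℝ) ^ (-c) ≤ (n : ℝ) ^ (-1 : ℝ) :=
        Real.rpow_le_rpow_of_exponent_le (by linarith) (by linarith)
    _ = 1 / n := by rw [Real.rpow_neg_one, one_div]
    _ ≤ 1 / 2 := one_div_le_one_div_of_le two_pos hn'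

lemma nodeWt_pos {n : ℕ} {c : ℝ} (hn : 2 ≤ n) (hc : 1 ≤ c) (Y : Fin n → ℝ) (j : ℕ) :
    0 < nodeWt n c Y j := by
  obtain ⟨h0, h1⟩ := splitP_bounds hn hc
  have : 0 < 1 - splitP n c := by linarith
  unfold nodeWt
  positivity

lemma postWt_eq_mul_prod {L n : ℕ} {c : ℝ} (Y : Fin n → ℝ) {S : Finset ℕ} (hS : S ∈ trees L) :
    postWt n (splitP n c) Y S =
      (2 * π) ^ (-(n : ℝ) / 2) * Real.exp (-(1 / 2) * ∑ i, Y i ^ 2) * ∏ j ∈ S, nodeWt n c Y j := by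
  simp only [postWt, priorWt, margLik, nodeWt]
  rw [card_extSet (mem_trees.1 hS), prod_mul_distrib, prod_const, mul_pow, mul_pow,
    ← Real.exp_sum, ← sum_div, ← Real.rpow_mul_natCast (by positivity)]
  rw [show -(1 / 2) * ((∑ i, Y i ^ 2) - (1 / ((n : ℝ) + 1)) * ∑ j ∈ S, colDot n Y j ^ 2) =
      -(1 / 2) * (∑ i, Y i ^ 2) + (∑ j ∈ S, colDot n Y j ^ 2) / (2 * (n + 1)) by field_simp; ring,
    Real.exp_add, show -(S.card : ℝ) / 2 = -1 / 2 * S.card by ring]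
  ring

lemma postRatio_of_subset {L n : ℕ} {c : ℝ} (hn : 2 ≤ n) (hc : 1 ≤ c) (Y : Fin n → ℝ)
    {S S' : Finset ℕ} (hS : S ∈ trees L) (hS' : S' ∈ trees L) (h : S ⊆ S') :
    postRatio L n c Y S S' = ∏ j ∈ S' \ S, nodeWt n c Y j := by
  have hprod : ∀ T : Finset ℕ, 0 < ∏ j ∈ T, nodeWt n c Y j :=
    fun T => prod_pos fun j _ => nodeWt_pos hn hc Y j
  have hpos : ∀ T ∈ trees L, 0 < postWt n (splitP n c) Y T := fun T hT => by
    rw [postWt_eq_mul_prod Y hT]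
    exact mul_pos (by positivity) (hprod T)
  have hZ : 0 < ∑ T ∈ trees L, postWt n (splitP n c) Y T := sum_pos hpos ⟨S, hS⟩
  rw [postRatio, post, post, div_div_div_cancel_right₀ hZ.ne', postWt_eq_mul_prod Y hS,
    postWt_eq_mul_prod Y hS', mul_div_mul_left _ _ (by positivity), ← prod_sdiff h,
    mul_div_cancel_right₀ _ (hprod S).ne']

lemma postRatio_of_superset {L n : ℕ} {c : ℝ} (hn : 2 ≤ n) (hc : 1 ≤ c) (Y : Fin n → ℝ)
    {S S' : Finset ℕ} (hS : S ∈ trees L) (hS' : S' ∈ trees L) (h : S' ⊆ S) :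
    postRatio L n c Y S S' = (∏ j ∈ S \ S', nodeWt n c Y j)⁻¹ := by
  rw [← postRatio_of_subset hn hc Y hS' hS h, postRatio, postRatio, inv_div]

/-! ## Size of the node contributions -/

lemma nodeWt_le {n : ℕ} {c : ℝ} (hn : 2 ≤ n) (hc : 1 ≤ c) {Y : Fin n → ℝ} {j : ℕ}
    (hY : |colDot n Y j| ≤ √(4 * n * Real.log n)) :
    nodeWt n c Y j ≤ (n : ℝ) ^ (-(c - 3 / 2)) := by
  have hnR : (0 : ℝ) < n := by positivity
  have hlog : 0 ≤ Real.log n := Real.log_natCast_nonneg n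
  obtain ⟨h0, h1⟩ := splitP_bounds hn hc
  have hexp : Real.exp (colDot n Y j ^ 2 / (2 * (n + 1))) ≤ (n : ℝ) ^ (2 : ℝ) := by
    rw [Real.rpow_def_of_pos hnR, Real.exp_le_exp, div_le_iff₀ (by positivity)]
    have := sq_le_sq' (neg_le_of_abs_le hY) (le_of_abs_le hY)
    rw [Real.sq_sqrt (by positivity)] at this
    nlinarith
  have hsqrt : (1 + n : ℝ) ^ (-(1 : ℝ) / 2) ≤ (n : ℝ) ^ (-(1 : ℝ) / 2) :=
    Real.rpow_le_rpow_of_nonpos hnR (by linarith) (by norm_num)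
  calc nodeWt n c Y j
      ≤ splitP n c * 1 * (n : ℝ) ^ (-(1 : ℝ) / 2) * (n : ℝ) ^ (2 : ℝ) := by
        unfold nodeWt
        gcongr
        linarith
    _ = (n : ℝ) ^ (-(c - 3 / 2)) := by
        rw [splitP, mul_one, ← Real.rpow_add hnR, ← Real.rpow_add hnR]
        congr 1
        ring

lemma le_nodeWt {n : ℕ} {c : ℝ} (hn : 2 ≤ n) (hc : 1 ≤ c) (Y : Fin n → ℝ) (j : ℕ) :
    (n : ℝ) ^ (-(c + 2)) * Real.exp (colDot n Y j ^ 2 / (2 * (n + 1))) ≤ nodeWt n c Y j := by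
  have hn' : (2 : ℝ) ≤ n := by exact_mod_cast hn
  have hnR : (0 : ℝ) < n := by positivity
  obtain ⟨h0, h1⟩ := splitP_bounds hn hc
  have hhalf : (n : ℝ) ^ (-1 : ℝ) ≤ 1 - splitP n c := by
    have : (n : ℝ)⁻¹ ≤ 2⁻¹ := inv_anti₀ two_pos hn'
    rw [Real.rpow_neg_one]
    linarith
  have hsqrt : (n : ℝ) ^ (-1 : ℝ) ≤ (1 + n : ℝ) ^ (-(1 : ℝ) / 2) := by
    rw [show (n : ℝ) ^ (-1 : ℝ) = ((n : ℝ) ^ (2 : ℝ)) ^ (-(1 : ℝ) / 2) by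
      rw [← Real.rpow_mul hnR.le]; norm_num]
    refine Real.rpow_le_rpow_of_nonpos (by positivity) (?_ : 1 + (n : ℝ) ≤ _) (by norm_num)
    rw [Real.rpow_two]
    nlinarith
  calc _ = splitP n c * (n : ℝ) ^ (-1 : ℝ) * (n : ℝ) ^ (-1 : ℝ) *
        Real.exp (colDot n Y j ^ 2 / (2 * (n + 1))) := by
        rw [splitP, ← Real.rpow_add hnR, ← Real.rpow_add hnR]
        congr 2
        ring
    _ ≤ nodeWt n c Y j := by
        have : 0 ≤ 1 - splitP n c := by linarith
        unfold nodeWt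
        gcongr

/-- One strong coefficient outweighs the prior cost of up to `2 log n` nodes. -/
lemma one_le_prod_nodeWt {n : ℕ} {c A : ℝ} (hn : 2 ≤ n) (hc : 1 ≤ c) (hA : 0 ≤ A)
    (hAc : 32 * (c + 2) ≤ A ^ 2) {Y : Fin n → ℝ} {D : Finset ℕ}
    (hD : (D.card : ℝ) ≤ 2 * Real.log n) {b : ℕ} (hb : b ∈ D)
    (hYb : A * Real.log n * √n / 2 ≤ |colDot n Y b|) :
    1 ≤ ∏ j ∈ D, nodeWt n c Y j := by
  have hn' : (2 : ℝ) ≤ n := by exact_mod_cast hn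
  have hnR : (0 : ℝ) < n := by positivity
  have hlog : 0 ≤ Real.log n := Real.log_natCast_nonneg n
  set r := (n : ℝ) ^ (-(c + 2)) with hr
  set E := Real.exp (A ^ 2 * Real.log n ^ 2 / 16) with hE
  have hsq : A ^ 2 * Real.log n ^ 2 / 16 ≤ colDot n Y b ^ 2 / (2 * (n + 1)) := by
    have h := pow_le_pow_left₀ (by positivity) hYb 2
    rw [sq_abs, div_pow, mul_pow, mul_pow, Real.sq_sqrt hnR.le] at h
    rw [le_div_iff₀ (by positivity)]
    have := mul_nonneg (sq_nonneg A) (sq_nonneg (Real.log n))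
    nlinarith
  have hnode : ∀ j ∈ D, r * (if b = j then E else 1) ≤ nodeWt n c Y j := by
    intro j _
    refine le_trans (mul_le_mul_of_nonneg_left ?_ (by positivity)) (le_nodeWt hn hc Y j)
    split_ifs with h
    · subst h
      exact Real.exp_le_exp.2 hsq
    · exact Real.one_le_exp (by positivity)
  refine le_trans ?_ (prod_le_prod (fun j _ => ?_) hnode)
  · rw [prod_mul_distrib, prod_const, prod_ite_eq, if_pos hb, hr, hE,
      ← Real.rpow_mul_natCast hnR.le, Real.rpow_def_of_pos hnR, ← Real.exp_add]
    refine Real.one_le_exp ?_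
    have h1 := mul_le_mul_of_nonneg_left hD (mul_nonneg hlog (by linarith : 0 ≤ c + 2))
    have h2 := mul_le_mul_of_nonneg_right hAc (sq_nonneg (Real.log n))
    linarith
  · split_ifs <;> positivity

/-! ## Informed weights on the noise event -/

lemma wg_le_of_mem_grow {L n : ℕ} {c A : ℝ} (hn : 2 ≤ n) (hc : 3 / 2 ≤ c) {Y : Fin n → ℝ}
    {S S' : Finset ℕ} (hS : S ∈ trees L) (hS' : S' ∈ bNg L S ∪ tNg L S)
    (hY : ∀ j < 2 ^ L, j ∉ S → |colDot n Y j| ≤ √(4 * n * Real.log n)) :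
    wg L n c A Y S S' ≤ (n : ℝ) ^ (-(c - 3 / 2)) := by
  obtain ⟨hT, hss⟩ := ssubset_of_mem_grow hS hS'
  have hn1 : (1 : ℝ) ≤ n := by exact_mod_cast one_le_two.trans hn
  refine (min_le_left _ _).trans ?_
  rw [postRatio_of_subset hn (by linarith) Y hS hT hss.1]
  calc ∏ j ∈ S' \ S, nodeWt n c Y j
      ≤ ∏ _j ∈ S' \ S, (n : ℝ) ^ (-(c - 3 / 2)) := by
        refine prod_le_prod (fun j _ => (nodeWt_pos hn (by linarith) Y j).le) fun j hj => ?_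
        rw [mem_sdiff] at hj
        exact nodeWt_le hn (by linarith) (hY j ((mem_trees.1 hT).2.2 j hj.1) hj.2)
    _ = ((n : ℝ) ^ (-(c - 3 / 2))) ^ (S' \ S).card := prod_const _
    _ ≤ (n : ℝ) ^ (-(c - 3 / 2)) :=
        pow_le_of_le_one (by positivity) (Real.rpow_le_one_of_one_le_of_nonpos hn1 (by linarith))
          (card_ne_zero.2 (sdiff_nonempty.2 hss.2))

lemma Zg_le {L n : ℕ} {c A : ℝ} (hn : 2 ≤ n) (hL : 2 * 2 ^ L ≤ n) (hc : 3 / 2 ≤ c)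
    {Y : Fin n → ℝ} {S : Finset ℕ} (hS : S ∈ trees L) {Ng : Finset ℕ → Finset (Finset ℕ)}
    (hcard : (Ng S).card ≤ 2 ^ L) (hNg : Ng S ⊆ bNg L S ∪ tNg L S)
    (hY : ∀ j < 2 ^ L, j ∉ S → |colDot n Y j| ≤ √(4 * n * Real.log n)) :
    Zg L n c A Y Ng S ≤ (n : ℝ) ^ (-(c - 5 / 2)) / 2 := by
  have hnR : (0 : ℝ) < n := by positivity
  have hcard' : ((Ng S).card : ℝ) ≤ n / 2 := by
    rw [le_div_iff₀ two_pos]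
    exact_mod_cast (by omega : (Ng S).card * 2 ≤ n)
  calc Zg L n c A Y Ng S
      ≤ (Ng S).card • (n : ℝ) ^ (-(c - 3 / 2)) :=
        sum_le_card_nsmul _ _ _ fun T hT => wg_le_of_mem_grow hn hc hS (hNg hT) hY
    _ ≤ n / 2 * (n : ℝ) ^ (-(c - 3 / 2)) := by
        rw [nsmul_eq_mul]
        gcongr
    _ = (n : ℝ) ^ (-(c - 5 / 2)) / 2 := by
        rw [show -(c - 5 / 2) = 1 + -(c - 3 / 2) by ring, Real.rpow_add hnR, Real.rpow_one]
        ring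

/-- Removing only pure-noise nodes: the informed PRUNE weight is at its upper cap. -/
lemma wp_eq_of_noise {L n : ℕ} {c : ℝ} (hn : 2 ≤ n) (hc : 3 / 2 ≤ c) {Y : Fin n → ℝ}
    {S S' : Finset ℕ} (hS : S ∈ trees L) (hS' : S' ∈ bNp S ∪ tNp S)
    (hY : ∀ j ∈ S \ S', |colDot n Y j| ≤ √(4 * n * Real.log n)) :
    wp L n c Y S S' = (n : ℝ) ^ (c - 3 / 2) := by
  obtain ⟨hT, hss, -⟩ := ssubset_of_mem_prune hS hS'
  have hn1 : (1 : ℝ) ≤ n := by exact_mod_cast one_le_two.trans hn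
  have hprod : ∏ j ∈ S \ S', nodeWt n c Y j ≤ (n : ℝ) ^ (-(c - 3 / 2)) := by
    calc ∏ j ∈ S \ S', nodeWt n c Y j
        ≤ ∏ _j ∈ S \ S', (n : ℝ) ^ (-(c - 3 / 2)) :=
          prod_le_prod (fun j _ => (nodeWt_pos hn (by linarith) Y j).le) fun j hj =>
            nodeWt_le hn (by linarith) (hY j hj)
      _ = ((n : ℝ) ^ (-(c - 3 / 2))) ^ (S \ S').card := prod_const _
      _ ≤ (n : ℝ) ^ (-(c - 3 / 2)) :=
          pow_le_of_le_one (by positivity)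
            (Real.rpow_le_one_of_one_le_of_nonpos hn1 (by linarith))
            (card_ne_zero.2 (sdiff_nonempty.2 hss.2))
  have hratio : (n : ℝ) ^ (c - 3 / 2) ≤ postRatio L n c Y S S' := by
    rw [postRatio_of_superset hn (by linarith) Y hS hT hss.1, ← neg_neg (c - 3 / 2),
      Real.rpow_neg (by positivity)]
    exact inv_anti₀ (prod_pos fun j _ => nodeWt_pos hn (by linarith) Y j) hprod
  rw [wp, min_eq_right hratio, max_eq_right (Real.one_le_rpow hn1 (by linarith))]

/-- Removing a strong coefficient: the informed PRUNE weight is at its lower cap. -/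
lemma wp_eq_one_of_signal {L n : ℕ} {c A : ℝ} (hn : 2 ≤ n) (hc : 1 ≤ c) (hA : 0 ≤ A)
    (hAc : 32 * (c + 2) ≤ A ^ 2) (hL : (L : ℝ) ≤ 2 * Real.log n) {Y : Fin n → ℝ}
    {S S' : Finset ℕ} (hS : S ∈ trees L) (hS' : S' ∈ bNp S ∪ tNp S) {b : ℕ}
    (hb : b ∈ S \ S') (hYb : A * Real.log n * √n / 2 ≤ |colDot n Y b|) :
    wp L n c Y S S' = 1 := by
  obtain ⟨hT, hss, hcard⟩ := ssubset_of_mem_prune hS hS'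
  rw [wp, max_eq_left ((min_le_left _ _).trans ?_)]
  rw [postRatio_of_superset hn hc Y hS hT hss.1]
  exact inv_le_one_of_one_le₀ (one_le_prod_nodeWt hn hc hA hAc
    ((Nat.cast_le.2 hcard).trans hL) hb hYb)

/-- A strong signal stays strong after adding noise on the noise event. -/
lemma le_abs_signal_add_noise {n : ℕ} {A b e : ℝ} (hA : 8 ≤ A) (hlog : 1 / 4 ≤ Real.log n)
    (hb : A * Real.log n / √n < |b|) (he : |e| ≤ √(4 * n * Real.log n)) :
    A * Real.log n * √n / 2 ≤ |n * b + e| := by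
  have hn0 : (0 : ℝ) < n := by
    rcases Nat.eq_zero_or_pos n with rfl | h
    · norm_num at hlog
    · exact_mod_cast h
  have hs : 0 < √(n : ℝ) := Real.sqrt_pos.2 hn0
  have hnoise : √(4 * n * Real.log n) ≤ 4 * (√n * Real.log n) := by
    refine Real.sqrt_le_iff.2 ⟨by positivity, ?_⟩
    rw [mul_pow, mul_pow, Real.sq_sqrt hn0.le]
    nlinarith [mul_nonneg (mul_nonneg hn0.le (by linarith : 0 ≤ Real.log n))
      (sub_nonneg.2 hlog)]
  have hsignal : A * Real.log n * √n ≤ n * |b| := by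
    rw [div_lt_iff₀ hs] at hb
    calc A * Real.log n * √n ≤ |b| * √n * √n := by gcongr
      _ = n * |b| := by rw [mul_assoc, Real.mul_self_sqrt hn0.le, mul_comm]
  have habs : |(n : ℝ) * b| - |e| ≤ |n * b + e| := by
    simpa using abs_sub_abs_le_abs_sub ((n : ℝ) * b) (-e)
  rw [abs_mul, abs_of_pos hn0] at habs
  have := mul_le_mul_of_nonneg_right hA (mul_nonneg hs.le (by linarith : 0 ≤ Real.log n))
  linarith

lemma Zp_bNp_eq {L n : ℕ} {c : ℝ} {Y : Fin n → ℝ} {S Sstar : Finset ℕ} (hsub : Sstar ⊆ S)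
    (hwp : ∀ S' ∈ bNp S ∪ tNp S, (Sstar ⊆ S' → wp L n c Y S S' = (n : ℝ) ^ (c - 3 / 2)) ∧
      (¬ Sstar ⊆ S' → wp L n c Y S S' = 1)) :
    Zp L n c Y bNp S = ((pruneCands S ∩ Sstar).card : ℝ) +
      ((pruneCands S \ Sstar).card : ℝ) * (n : ℝ) ^ (c - 3 / 2) := by
  have hinj : Set.InjOn (fun j => S.erase j) (pruneCands S : Set ℕ) := by
    intro a ha b _ hab
    by_contra hne
    have : a ∈ S.erase b := mem_erase.2 ⟨hne, (mem_filter.1 ha).1⟩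
    rw [← show S.erase a = S.erase b from hab] at this
    exact notMem_erase a S this
  have hmem : ∀ j ∈ pruneCands S, S.erase j ∈ bNp S ∪ tNp S := fun j hj =>
    mem_union_left _ (mem_image_of_mem _ hj)
  rw [Zp, bNp, sum_image hinj, ← sum_inter_add_sum_sdiff (pruneCands S) Sstar]
  congr 1
  · rw [← nsmul_one, ← sum_const]
    refine sum_congr rfl fun j hj => ?_
    rw [mem_inter] at hj
    exact (hwp _ (hmem j hj.1)).2 fun h => notMem_erase j S (h hj.2)
  · rw [← nsmul_eq_mul, ← sum_const]
    refine sum_congr rfl fun j hj => ?_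
    rw [mem_sdiff] at hj
    exact (hwp _ (hmem j hj.1)).1 (subset_erase.2 ⟨hsub, hj.2⟩)

/-- **Lemma (Normalizer bounds for informed proposals at overfitted trees).**
Under the assumptions of the informed-mixing theorem, with probability at least
`1 − 4/n − e^{−n/8}` over `ε ~ N(0, I_n)`, for every overfitted tree `𝒯 ⊇ 𝒯*`:
(i) `Z_g(𝒯) ≤ n^{−(c−5/2)}/2` (for the single-node and the twig GROW neighborhoods);
(ii) for every PRUNE-neighbor `𝒯̃ ⊂ 𝒯`, `w_p(𝒯̃|𝒯) = n^{c−3/2}` if `𝒯̃ ⊇ 𝒯*` and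
`w_p(𝒯̃|𝒯) = 1` otherwise;
(iii) for the informed Bayesian CART, `Z_p(𝒯) ≤ |a_𝒯| + |b_𝒯| n^{c−3/2}` with
`a_𝒯 = 𝒫(𝒯) ∩ 𝒯*_int` and `b_𝒯 = 𝒫(𝒯) ∖ 𝒯*_int`. -/
theorem informed_normalizers_overfitted (c : ℝ) (hc : 5 / 2 < c) :
    ∃ (A₀ : ℝ) (N : ℕ), 0 < A₀ ∧ ∀ A ≥ A₀,
      ∀ (Lmax L n : ℕ), n = 2 ^ (Lmax + 1) → L ≤ Lmax → N ≤ n →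
      ∀ (C : ℝ) (β : ℕ → ℝ) (B Sstar : Finset ℕ), Assumption1 L n A C β B Sstar →
      ENNReal.ofReal (1 - 4 / n - Real.exp (-(n : ℝ) / 8)) ≤
        gauss n {ε | ∀ S ∈ trees L, Sstar ⊆ S →
          (Zg L n c A (Yvec n β B ε) (bNg L) S ≤ (n : ℝ) ^ (-(c - 5 / 2)) / 2 ∧
            Zg L n c A (Yvec n β B ε) (tNg L) S ≤ (n : ℝ) ^ (-(c - 5 / 2)) / 2) ∧
          (∀ S' ∈ bNp S ∪ tNp S,
            (Sstar ⊆ S' → wp L n c (Yvec n β B ε) S S' = (n : ℝ) ^ (c - 3 / 2)) ∧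
            (¬ Sstar ⊆ S' → wp L n c (Yvec n β B ε) S S' = 1)) ∧
          Zp L n c (Yvec n β B ε) bNp S ≤
            ((pruneCands S ∩ Sstar).card : ℝ) +
              ((pruneCands S \ Sstar).card : ℝ) * (n : ℝ) ^ (c - 3 / 2)} := by
  refine ⟨8 + 32 * (c + 2), 0, by linarith, ?_⟩
  intro A hA Lmax L n hn hLmax _ C β B Sstar hAss
  have hn2 : 2 ≤ n := by rw [hn]; exact Nat.le_self_pow (by omega) 2
  have hLM : 2 ^ L ≤ 2 ^ Lmax := Nat.pow_le_pow_right two_pos hLmax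
  have hA8 : 8 ≤ A := by linarith
  have hAc : 32 * (c + 2) ≤ A ^ 2 := by nlinarith
  have hlogn : Real.log n = (Lmax + 1) * Real.log 2 := by
    rw [hn]
    push_cast
    rw [Real.log_pow]
    push_cast
    ring
  have hLmaxR : (L : ℝ) ≤ Lmax := by exact_mod_cast hLmax
  have hlog : 1 / 4 ≤ Real.log n := by
    rw [hlogn]
    nlinarith [Real.log_two_gt_d9, (Nat.cast_nonneg Lmax : (0 : ℝ) ≤ Lmax)]
  have hL : (L : ℝ) ≤ 2 * Real.log n := by
    rw [hlogn]
    nlinarith [Real.log_two_gt_d9, (Nat.cast_nonneg Lmax : (0 : ℝ) ≤ Lmax)]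
  have hprob : 1 - 4 / (n : ℝ) - Real.exp (-(n : ℝ) / 8) ≤ 1 - 1 / n := by
    have : 1 / (n : ℝ) ≤ 4 / n := by gcongr; norm_num
    linarith [Real.exp_pos (-(n : ℝ) / 8)]
  refine (ENNReal.ofReal_le_ofReal hprob).trans
    ((le_gauss_noise_event hn).trans (measure_mono fun ε hε S hS hsub => ?_))
  have hε : ∀ j < 2 ^ Lmax, |colDot n ε j| ≤ √(4 * n * Real.log n) := hε
  have hdot : ∀ j < 2 ^ L, colDot n (Yvec n β B ε) j = n * β j + colDot n ε j := fun j hj =>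
    colDot_Yvec hn (hj.trans_le hLM) (fun k hk => (hAss.B_depth k hk).trans_le hLM)
      hAss.support ε
  have hnoise : ∀ j < 2 ^ L, j ∉ Sstar →
      |colDot n (Yvec n β B ε) j| ≤ √(4 * n * Real.log n) := by
    intro j hj hjS
    rw [hdot j hj, hAss.support j fun h => hjS (hAss.Sstar_contains h), mul_zero, zero_add]
    exact hε j (hj.trans_le hLM)
  have hnoise' : ∀ j < 2 ^ L, j ∉ S →
      |colDot n (Yvec n β B ε) j| ≤ √(4 * n * Real.log n) :=
    fun j hj hjS => hnoise j hj fun h => hjS (hsub h)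
  have hLn : 2 * 2 ^ L ≤ n := by rw [hn, pow_succ]; omega
  have hwp : ∀ S' ∈ bNp S ∪ tNp S,
      (Sstar ⊆ S' → wp L n c (Yvec n β B ε) S S' = (n : ℝ) ^ (c - 3 / 2)) ∧
      (¬ Sstar ⊆ S' → wp L n c (Yvec n β B ε) S S' = 1) := by
    refine fun S' hS' => ⟨fun h => ?_, fun h => ?_⟩
    · refine wp_eq_of_noise hn2 (by linarith) hS hS' fun j hj => ?_
      rw [mem_sdiff] at hj
      exact hnoise j ((mem_trees.1 hS).2.2 j hj.1) fun h' => hj.2 (h h')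
    · have hB : ¬ B ⊆ S' := fun hB =>
        h (hAss.Sstar_min S' (ssubset_of_mem_prune hS hS').1 hB)
      obtain ⟨b, hbB, hbS'⟩ := not_subset.1 hB
      have hbL := hAss.B_depth b hbB
      refine wp_eq_one_of_signal hn2 (by linarith) (by linarith) hAc hL hS hS'
        (mem_sdiff.2 ⟨hsub (hAss.Sstar_contains hbB), hbS'⟩) ?_
      rw [hdot b hbL]
      exact le_abs_signal_add_noise hA8 hlog (hAss.signal_low b hbB) (hε b (hbL.trans_le hLM))
  exact ⟨⟨Zg_le hn2 hLn (by linarith) hS (card_grow_le S).1 subset_union_left hnoise',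
    Zg_le hn2 hLn (by linarith) hS (card_grow_le S).2 subset_union_right hnoise'⟩,
    hwp, (Zp_bNp_eq hsub hwp).le⟩

end BayesCART
end
end

section
/- Relating posterior ratios to the first drift ratio: Let 𝒯, 𝒯̃ ∈ 𝕋_L and suppose B(𝒯,𝒯̃) = Π(𝒯̃|Y)/Π(𝒯|Y) ≥ n^a for some a ∈ ℝ. Define b = (2^{L−1}(C_{f_0}+2)² n)^{−1} · ( a·log n − log(Π(𝒯̃)/Π(𝒯)) − ((|𝒯_ext| − |𝒯̃_ext|)/2)·log(1+n) ). If b ∈ [0,1], then −R₁(𝒯,𝒯̃) ≥ b/2. -/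
open Finset MeasureTheory Real
open scoped BigOperators NNReal ENNReal

noncomputable section

namespace BayesCART

/-- `1 - e^{-x} ≥ b / 2` whenever `b ∈ [0, 1]` and `x ≥ b`. -/
lemma half_le_one_sub_exp_neg {b x : ℝ} (h0 : 0 ≤ b) (h1 : b ≤ 1) (hx : b ≤ x) :
    b / 2 ≤ 1 - Real.exp (-x) := by
  have hmono : Real.exp (-x) ≤ Real.exp (-b) := Real.exp_le_exp.mpr (by linarith)
  have hmul : Real.exp (-b) * Real.exp b = 1 := by
    rw [← Real.exp_add, neg_add_cancel, Real.exp_zero]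
  nlinarith [Real.add_one_le_exp b, Real.exp_pos (-b), mul_nonneg h0 (sub_nonneg.mpr h1)]

lemma eq_singleton_of_mem_trees_zero {S : Finset ℕ} (hS : S ∈ trees 0) : S = {0} := by
  obtain ⟨-, h0, -, hlt⟩ := Finset.mem_filter.mp hS
  ext j
  rw [Finset.mem_singleton]
  exact ⟨fun hj => by simpa using hlt j hj, fun hj => hj ▸ h0⟩

lemma margLik_pos (n : ℕ) (Y : Fin n → ℝ) (S : Finset ℕ) : 0 < margLik n Y S := by
  unfold margLik
  positivity

/-- The normalizing constant cancels in a nonzero posterior ratio. -/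
lemma postRatio_eq_of_ne_zero {L n : ℕ} {c : ℝ} {Y : Fin n → ℝ} {S S' : Finset ℕ}
    (h : postRatio L n c Y S S' ≠ 0) :
    postRatio L n c Y S S' = priorWt (splitP n c) S' / priorWt (splitP n c) S *
      (margLik n Y S' / margLik n Y S) := by
  have hZ : ∑ T ∈ trees L, postWt n (splitP n c) Y T ≠ 0 := fun hZ =>
    h (by simp [postRatio, post, hZ])
  unfold postRatio post
  rw [div_div_div_cancel_right₀ hZ]
  unfold postWt
  rw [mul_div_mul_comm]

lemma log_margLik_div (n : ℕ) (Y : Fin n → ℝ) (S S' : Finset ℕ) :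
    Real.log (margLik n Y S' / margLik n Y S) =
      (((extSet S).card : ℝ) - ((extSet S').card : ℝ)) / 2 * Real.log (1 + n) +
        (∑ j ∈ S', colDot n Y j ^ 2 - ∑ j ∈ S, colDot n Y j ^ 2) / (2 * ((n : ℝ) + 1)) := by
  have hn : (0 : ℝ) < 1 + n := by positivity
  have hlog (T : Finset ℕ) : Real.log (margLik n Y T) =
      -(n : ℝ) / 2 * Real.log (2 * π) + -((extSet T).card : ℝ) / 2 * Real.log (1 + n) +
        -(1 / 2) * ((∑ i, Y i ^ 2) - (1 / ((n : ℝ) + 1)) * ∑ j ∈ T, colDot n Y j ^ 2) := by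
    unfold margLik
    rw [Real.log_mul (by positivity) (Real.exp_ne_zero _),
      Real.log_mul (by positivity) (by positivity), Real.log_exp,
      Real.log_rpow (by positivity), Real.log_rpow hn]
  rw [Real.log_div (margLik_pos n Y S').ne' (margLik_pos n Y S).ne', hlog, hlog]
  field_simp
  ring

lemma driftR_V1 (L n : ℕ) (C : ℝ) (Y : Fin n → ℝ) (S S' : Finset ℕ) :
    driftR (V1 L n C Y) S S' =
      Real.exp (-(1 / (2 ^ L * (C + 2) ^ 2 * ((n : ℝ) + 1)) * (1 / n) *
        (∑ j ∈ S', colDot n Y j ^ 2 - ∑ j ∈ S, colDot n Y j ^ 2))) - 1 := by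
  unfold driftR V1
  rw [← Real.exp_sub]
  ring_nf

/-- **Lemma (Relating posterior ratios to the first drift ratio).**
Let `𝒯, 𝒯̃ ∈ 𝕋_L` and suppose `B(𝒯,𝒯̃) = Π(𝒯̃|Y)/Π(𝒯|Y) ≥ n^a` for some `a ∈ ℝ`.
With `b = (2^{L−1}(C_{f₀}+2)²n)^{−1}(a log n − log(Π(𝒯̃)/Π(𝒯))
  − ((|𝒯_ext| − |𝒯̃_ext|)/2) log(1+n))`, if `b ∈ [0,1]` then `−R₁(𝒯,𝒯̃) ≥ b/2`.
(This lemma is deterministic in `Y`.) -/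
theorem posterior_ratio_drift_lemma
    (Lmax L n : ℕ) (hn : n = 2 ^ (Lmax + 1)) (hL : L ≤ Lmax)
    (c C : ℝ) (Y : Fin n → ℝ) (S S' : Finset ℕ)
    (hS : S ∈ trees L) (hS' : S' ∈ trees L)
    (a : ℝ) (hB : (n : ℝ) ^ a ≤ postRatio L n c Y S S') :
    (1 / (2 ^ (L - 1) * (C + 2) ^ 2 * n) *
        (a * Real.log n - Real.log (priorWt (splitP n c) S' / priorWt (splitP n c) S) -
          (((extSet S).card : ℝ) - ((extSet S').card : ℝ)) / 2 * Real.log (1 + n)))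
        ∈ Set.Icc (0 : ℝ) 1 →
      (1 / (2 ^ (L - 1) * (C + 2) ^ 2 * n) *
          (a * Real.log n - Real.log (priorWt (splitP n c) S' / priorWt (splitP n c) S) -
            (((extSet S).card : ℝ) - ((extSet S').card : ℝ)) / 2 * Real.log (1 + n))) / 2
        ≤ -driftR (V1 L n C Y) S S' := by
  rintro ⟨hb0, hb1⟩
  have hn0 : (0 : ℝ) < n := by rw [hn]; positivity
  have hpow : (0 : ℝ) < (n : ℝ) ^ a := Real.rpow_pos_of_pos hn0 a
  have hne : postRatio L n c Y S S' ≠ 0 := (hpow.trans_le hB).ne'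
  have hlog := Real.log_le_log hpow hB
  have hratio := postRatio_eq_of_ne_zero hne
  rw [hratio] at hne hlog
  rw [Real.log_rpow hn0, Real.log_mul (left_ne_zero_of_mul hne) (right_ne_zero_of_mul hne),
    log_margLik_div] at hlog
  rw [driftR_V1, neg_sub]
  refine half_le_one_sub_exp_neg hb0 hb1 ?_
  calc _ ≤ 1 / (2 ^ (L - 1) * (C + 2) ^ 2 * n) *
        ((∑ j ∈ S', colDot n Y j ^ 2 - ∑ j ∈ S, colDot n Y j ^ 2) / (2 * ((n : ℝ) + 1))) :=
        mul_le_mul_of_nonneg_left (by linarith) (by positivity)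
    _ = _ := by
        cases L with
        | zero =>
          rw [eq_singleton_of_mem_trees_zero hS, eq_singleton_of_mem_trees_zero hS']
          simp
        | succ L =>
          rw [Nat.add_sub_cancel, pow_succ]
          simp only [mul_inv, div_eq_mul_inv]
          ring

end BayesCART
end
end
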